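/- arXiv:1407.4971 — 3 statements merged into one kernel-verified Lean document; each statement's English description precedes it below -/
import Mathlib

section
/- (Likelihood factorization under partially missing at random (PMAR), two-occasion case.) Suppose the mechanism factorizes as q_c(γ, δ, y₁, y₂) = K_c(γ, y₁, y₂) · Q_c(δ, y₁) for each c ∈ {1,…,C}, where the second factor Q_c depends on y = (y₁, y₂) only through the observed component y₁ (the PMAR condition for each missing pattern), and q₀(γ, δ, y₁, y₂) = K₀(γ, y₁, y₂) · Q₀(δ, y₁, y₂). Then FL(θ, γ, δ) = [∏_{i∈I₀} Q₀(δ, u_i, v_i) · ∏_{c=1}^C ∏_{j∈I_c} Q_c(δ, w_{c,j})] × [∏_{i∈I₀} K₀(γ, u_i, v_i) f(θ, u_i, v_i) · ∏_{c=1}^C ∏_{j∈I_c} ∫ K_c(γ, w_{c,j}, y₂) f(θ, w_{c,j}, y₂) dμ(y₂)]; in particular the parameter δ separates from the parameters (θ, γ). -/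
open MeasureTheory Finset

/-- Likelihood factorization under partially missing at random (PMAR),
two-occasion case.  If each missing-cause probability factorizes as
`q c = K c (γ, y₁, y₂) * Q c (δ, y₁)` with the `δ`-part depending only on the
observed `y₁`, and the observation probability `q₀ = 1 - ∑ q c` factorizes as
`K₀ * Q₀`, then the full likelihood separates the parameter `δ` from `(θ, γ)`. -/
theorem pmar_likelihood_factorization
    {Ω₂ Θ Γ Δ : Type*} [MeasurableSpace Ω₂] (μ : Measure Ω₂)
    (f : Θ → ℝ → Ω₂ → ℝ)
    (hf_nonneg : ∀ θ y₁ y₂, 0 ≤ f θ y₁ y₂)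
    (hf_meas : ∀ θ, Measurable (fun p : ℝ × Ω₂ => f θ p.1 p.2))
    (C n₀ : ℕ) (I : Fin C → ℕ)
    (u : Fin n₀ → ℝ) (v : Fin n₀ → Ω₂)
    (w : (c : Fin C) → Fin (I c) → ℝ)
    (q : Γ → Δ → Fin C → ℝ → Ω₂ → ℝ)
    (hq_nonneg : ∀ γ δ c y₁ y₂, 0 ≤ q γ δ c y₁ y₂)
    (hq_sum : ∀ γ δ y₁ y₂, ∑ c, q γ δ c y₁ y₂ ≤ 1)
    (K : Γ → Fin C → ℝ → Ω₂ → ℝ) (Q : Δ → Fin C → ℝ → ℝ)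
    (K₀ : Γ → ℝ → Ω₂ → ℝ) (Q₀ : Δ → ℝ → Ω₂ → ℝ)
    -- the PMAR factorization of each missing pattern's probability
    (hPMAR : ∀ γ δ c y₁ y₂, q γ δ c y₁ y₂ = K γ c y₁ y₂ * Q δ c y₁)
    -- the factorization of the observation probability q₀ = 1 - ∑ c, q c
    (hq₀ : ∀ γ δ y₁ y₂, 1 - ∑ c, q γ δ c y₁ y₂ = K₀ γ y₁ y₂ * Q₀ δ y₁ y₂) :
    ∀ (θ : Θ) (γ : Γ) (δ : Δ),
      -- full likelihood FL(θ, γ, δ)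
      ((∏ i, (1 - ∑ c, q γ δ c (u i) (v i)) * f θ (u i) (v i)) *
        ∏ c, ∏ j, ∫ y₂, q γ δ c (w c j) y₂ * f θ (w c j) y₂ ∂μ)
      =
      -- the δ-part, depending only on δ and the observed data
      ((∏ i, Q₀ δ (u i) (v i)) * ∏ c, ∏ j, Q δ c (w c j)) *
      -- the (θ, γ)-part
      ((∏ i, K₀ γ (u i) (v i) * f θ (u i) (v i)) *
        ∏ c, ∏ j, ∫ y₂, K γ c (w c j) y₂ * f θ (w c j) y₂ ∂μ) := by
  intro θ γ δ
  have h1 : ∀ c j, ∫ y₂, q γ δ c (w c j) y₂ * f θ (w c j) y₂ ∂μ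
      = Q δ c (w c j) * ∫ y₂, K γ c (w c j) y₂ * f θ (w c j) y₂ ∂μ := by
    intro c j
    rw [← integral_const_mul]
    congr 1
    funext y₂
    rw [hPMAR]
    ring
  have h2 : ∀ i, (1 - ∑ c, q γ δ c (u i) (v i)) * f θ (u i) (v i)
      = Q₀ δ (u i) (v i) * (K₀ γ (u i) (v i) * f θ (u i) (v i)) := by
    intro i
    rw [hq₀]
    ring
  simp_rw [h1, h2]
  simp only [Finset.prod_mul_distrib]
  ring
end

section
/- (The semi-direct likelihood gives the same MLE as the full likelihood under hierarchical 'MAR & NMAR' structure.) In the hierarchical two-cause model, fix τ₁ such that A(τ₁) := ∏_{i∈I₀} (1 − π(τ₁, u_i)) · ∏_{j∈I₁} π(τ₁, w_{1,j}) · ∏_{j∈I₂} (1 − π(τ₁, w_{2,j})) > 0. Then for every (θ*, τ₂*) ∈ Θ × T₂, the pair (θ*, τ₂*) maximizes the semi-direct likelihood SDL(θ, τ₂) = ∏_{i∈I₀} (1 − ρ(τ₂, v_i)) f(θ, u_i, v_i) · ∏_{j∈I₁} f₁(θ, w_{1,j}) · ∏_{j∈I₂} ∫ ρ(τ₂, y₂)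 f(θ, w_{2,j}, y₂) dμ(y₂) over Θ × T₂ if and only if it maximizes (θ, τ₂) ↦ FL(θ, τ₁, τ₂) over Θ × T₂; in particular the MAR cause 1 is ignorable when the causes of missingness are known. -/
open MeasureTheory Finset

/-- The semi-direct likelihood gives the same MLE as the full likelihood under
the hierarchical "MAR & NMAR" structure: if `A(τ₁) > 0`, then `(θ*, τ₂*)`
maximizes `SDL` over `Θ × T₂` iff it maximizes `(θ, τ₂) ↦ FL(θ, τ₁, τ₂)`;
the MAR cause 1 is ignorable when the causes of missingness are known. -/
theorem semi_direct_likelihood_same_mle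
    {Ω₂ Θ T₁ T₂ : Type*} [MeasurableSpace Ω₂] (μ : Measure Ω₂)
    (f : Θ → ℝ → Ω₂ → ℝ)
    (hf_nonneg : ∀ θ y₁ y₂, 0 ≤ f θ y₁ y₂)
    (hf_meas : ∀ θ, Measurable (fun p : ℝ × Ω₂ => f θ p.1 p.2))
    (n₀ n₁ n₂ : ℕ)
    (u : Fin n₀ → ℝ) (v : Fin n₀ → Ω₂)
    (w₁ : Fin n₁ → ℝ) (w₂ : Fin n₂ → ℝ)
    (π : T₁ → ℝ → ℝ) (ρ : T₂ → Ω₂ → ℝ)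
    (hπ : ∀ τ₁ y₁, π τ₁ y₁ ∈ Set.Icc (0 : ℝ) 1)
    (hρ : ∀ τ₂ y₂, ρ τ₂ y₂ ∈ Set.Icc (0 : ℝ) 1)
    (τ₁ : T₁)
    (hA : 0 < (∏ i, (1 - π τ₁ (u i))) * (∏ j, π τ₁ (w₁ j)) *
      (∏ j, (1 - π τ₁ (w₂ j)))) :
    ∀ (θs : Θ) (τ₂s : T₂),
      -- (θ*, τ₂*) maximizes the semi-direct likelihood SDL over Θ × T₂ ...
      (∀ (θ : Θ) (τ₂ : T₂),
        ((∏ i, (1 - ρ τ₂ (v i)) * f θ (u i) (v i)) *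
          (∏ j, ∫ y₂, f θ (w₁ j) y₂ ∂μ) *
          (∏ j, ∫ y₂, ρ τ₂ y₂ * f θ (w₂ j) y₂ ∂μ))
        ≤
        ((∏ i, (1 - ρ τ₂s (v i)) * f θs (u i) (v i)) *
          (∏ j, ∫ y₂, f θs (w₁ j) y₂ ∂μ) *
          (∏ j, ∫ y₂, ρ τ₂s y₂ * f θs (w₂ j) y₂ ∂μ)))
      ↔
      -- ... iff it maximizes (θ, τ₂) ↦ FL(θ, τ₁, τ₂) over Θ × T₂
      (∀ (θ : Θ) (τ₂ : T₂),
        ((∏ i, ((1 - π τ₁ (u i)) * (1 - ρ τ₂ (v i))) * f θ (u i) (v i)) *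
          (∏ j, ∫ y₂, π τ₁ (w₁ j) * f θ (w₁ j) y₂ ∂μ) *
          (∏ j, ∫ y₂, ((1 - π τ₁ (w₂ j)) * ρ τ₂ y₂) * f θ (w₂ j) y₂ ∂μ))
        ≤
        ((∏ i, ((1 - π τ₁ (u i)) * (1 - ρ τ₂s (v i))) * f θs (u i) (v i)) *
          (∏ j, ∫ y₂, π τ₁ (w₁ j) * f θs (w₁ j) y₂ ∂μ) *
          (∏ j, ∫ y₂, ((1 - π τ₁ (w₂ j)) * ρ τ₂s y₂) * f θs (w₂ j) y₂ ∂μ))) := by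
  intro θs τ₂s
  have key : ∀ (θ : Θ) (τ₂ : T₂),
      ((∏ i, ((1 - π τ₁ (u i)) * (1 - ρ τ₂ (v i))) * f θ (u i) (v i)) *
          (∏ j, ∫ y₂, π τ₁ (w₁ j) * f θ (w₁ j) y₂ ∂μ) *
          (∏ j, ∫ y₂, ((1 - π τ₁ (w₂ j)) * ρ τ₂ y₂) * f θ (w₂ j) y₂ ∂μ)) =
      ((∏ i, (1 - π τ₁ (u i))) * (∏ j, π τ₁ (w₁ j)) * (∏ j, (1 - π τ₁ (w₂ j)))) *
        ((∏ i, (1 - ρ τ₂ (v i)) * f θ (u i) (v i)) *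
          (∏ j, ∫ y₂, f θ (w₁ j) y₂ ∂μ) *
          (∏ j, ∫ y₂, ρ τ₂ y₂ * f θ (w₂ j) y₂ ∂μ)) := by
    intro θ τ₂
    simp only [mul_assoc, integral_const_mul, Finset.prod_mul_distrib]
    ring
  refine forall_congr' fun θ => forall_congr' fun τ₂ => ?_
  rw [key θ τ₂, key θs τ₂s]
  exact (mul_le_mul_iff_right₀ hA).symm
end

section
/- (Proposition 3: ignorability under hierarchical structure when missing causes are known, general number of causes.) Let S ⊆ {1,…,C} be a set of causes satisfying condition (2.1), i.e. p_c(τ_c, y₁, y₂) = p̃_c(τ_c, y₁) depends on y = (y₁, y₂) only through the observed y₁ for each c ∈ S. Then there exist a function A of ((τ_c)_{c∈S}, data) and a function B of (θ, (τ_c)_{c∉S}, data) such that FL(θ, τ₁,…,τ_C) = A((τ_c)_{c∈S}) · B(θ, (τ_c)_{c∉S}) for all parameter values; moreover A can be chosen so that A((τ_c)_{c∈S}) > 0 whenever 0 < p̃_c(τ_c, y₁) < 1 for every c ∈ S and every y₁ appearing in the data. Hence the causes in S are ignorable for likelihood inference on (θ, (τ_c)_{c∉S}). -/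
open MeasureTheory Finset

/-- contribution of cause `b` to the probability of being missing by cause `c` -/
noncomputable def causeFactor {C : ℕ} (c b : Fin C) (x : ℝ) : ℝ :=
  if b = c then x else if b < c then 1 - x else 1

lemma prod_causeFactor {C : ℕ} (c : Fin C) (x : Fin C → ℝ) :
    x c * ∏ b ∈ Finset.Iio c, (1 - x b) = ∏ b, causeFactor c b (x b) := by
  rw [← Finset.mul_prod_erase Finset.univ _ (Finset.mem_univ c)]
  congr 1
  · simp [causeFactor]
  · have hsub : Finset.Iio c ⊆ Finset.univ.erase c := by
      intro b hb
      simp only [Finset.mem_Iio] at hb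
      simp [hb.ne]
    rw [← Finset.prod_subset hsub]
    · refine Finset.prod_congr rfl fun b hb => ?_
      simp only [Finset.mem_Iio] at hb
      simp [causeFactor, hb.ne, hb]
    · intro b hb hb'
      have h1 : b ≠ c := Finset.ne_of_mem_erase hb
      have h2 : ¬ b < c := by simpa using hb'
      simp [causeFactor, h1, h2]

lemma causeFactor_pos {C : ℕ} (c b : Fin C) {x : ℝ} (h : 0 < x ∧ x < 1) :
    0 < causeFactor c b x := by
  unfold causeFactor
  split_ifs <;> linarith [h.1, h.2]

/-- Proposition 3: ignorability under hierarchical structure when the missing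
causes are known.  With priority order `1 > 2 > … > C`, missing-cause
probabilities `q_c = p_c ∏_{b<c} (1 - p_b)` and `q₀ = ∏_c (1 - p_c)`, if the
conditional probabilities `p_c` for the causes `c ∈ S` depend only on the
observed `y₁` (condition (2.1), `p_c = p̃_c(τ_c, y₁)`), then the full
likelihood factorizes as `FL(θ, τ) = A((τ_c)_{c∈S}) * B(θ, (τ_c)_{c∉S})`,
where `A` can be chosen positive whenever `0 < p̃_c < 1` on the data;
hence the causes in `S` are ignorable. -/
theorem hierarchical_known_causes_ignorable
    {Ω₂ Θ : Type*} [MeasurableSpace Ω₂] (μ : Measure Ω₂)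
    (C : ℕ) (T : Fin C → Type*)
    (f : Θ → ℝ → Ω₂ → ℝ)
    (hf_nonneg : ∀ θ y₁ y₂, 0 ≤ f θ y₁ y₂)
    (hf_meas : ∀ θ, Measurable (fun pr : ℝ × Ω₂ => f θ pr.1 pr.2))
    (n₀ : ℕ) (I : Fin C → ℕ)
    (u : Fin n₀ → ℝ) (v : Fin n₀ → Ω₂)
    (w : (c : Fin C) → Fin (I c) → ℝ)
    (p : (c : Fin C) → T c → ℝ → Ω₂ → ℝ)
    (hp : ∀ c τc y₁ y₂, p c τc y₁ y₂ ∈ Set.Icc (0 : ℝ) 1)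
    (S : Finset (Fin C))
    (p' : (c : Fin C) → T c → ℝ → ℝ)
    -- condition (2.1): for c ∈ S the conditional missing probability
    -- depends on (y₁, y₂) only through the observed y₁
    (hS : ∀ c ∈ S, ∀ (τc : T c) (y₁ : ℝ) (y₂ : Ω₂), p c τc y₁ y₂ = p' c τc y₁) :
    ∃ (A : ((c : {x : Fin C // x ∈ S}) → T c.val) → ℝ)
      (B : Θ → ((c : {x : Fin C // x ∉ S}) → T c.val) → ℝ),
      (∀ (θ : Θ) (τ : (c : Fin C) → T c),
        -- full likelihood FL(θ, τ₁, …, τ_C)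
        ((∏ i, (∏ c, (1 - p c (τ c) (u i) (v i))) * f θ (u i) (v i)) *
          ∏ c, ∏ j, ∫ y₂,
            (p c (τ c) (w c j) y₂ *
              ∏ b ∈ Finset.Iio c, (1 - p b (τ b) (w c j) y₂)) *
            f θ (w c j) y₂ ∂μ)
        = A (fun c => τ c.val) * B θ (fun c => τ c.val)) ∧
      (∀ τ : (c : Fin C) → T c,
        (∀ c ∈ S,
          (∀ i, 0 < p' c (τ c) (u i) ∧ p' c (τ c) (u i) < 1) ∧
          (∀ (c' : Fin C) (j : Fin (I c')),
            0 < p' c (τ c) (w c' j) ∧ p' c (τ c) (w c' j) < 1)) →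
        0 < A (fun c => τ c.val)) := by
  refine ⟨fun σ => (∏ i, ∏ c : {x : Fin C // x ∈ S}, (1 - p' c.val (σ c) (u i))) *
      ∏ c, ∏ j, ∏ b : {x : Fin C // x ∈ S}, causeFactor c b.val (p' b.val (σ b) (w c j)),
    fun θ σ => (∏ i, (∏ c : {x : Fin C // x ∉ S}, (1 - p c.val (σ c) (u i) (v i))) *
        f θ (u i) (v i)) *
      ∏ c, ∏ j, ∫ y₂, (∏ b : {x : Fin C // x ∉ S},
        causeFactor c b.val (p b.val (σ b) (w c j) y₂)) * f θ (w c j) y₂ ∂μ, ?_, ?_⟩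
  · intro θ τ
    dsimp only
    rw [mul_mul_mul_comm, ← Finset.prod_mul_distrib, ← Finset.prod_mul_distrib]
    congr 1
    · refine Finset.prod_congr rfl fun i _ => ?_
      rw [← mul_assoc, ← Fintype.prod_subtype_mul_prod_subtype (fun x => x ∈ S)]
      congr 2
      refine Finset.prod_congr (by ext; simp) fun c _ => ?_
      rw [hS c.val c.2]
    · refine Finset.prod_congr rfl fun c _ => ?_
      rw [← Finset.prod_mul_distrib]
      refine Finset.prod_congr rfl fun j _ => ?_
      rw [← integral_const_mul]
      congr 1
      funext y₂
      rw [prod_causeFactor c (fun b => p b (τ b) (w c j) y₂), ← mul_assoc,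
        ← Fintype.prod_subtype_mul_prod_subtype (fun x => x ∈ S)]
      congr 2
      refine Finset.prod_congr (by ext; simp) fun b _ => ?_
      rw [hS b.val b.2]
  · intro τ h
    refine mul_pos ?_ ?_
    · refine Finset.prod_pos fun i _ => Finset.prod_pos fun c _ => ?_
      have := ((h c.val c.2).1 i).2
      linarith
    · exact Finset.prod_pos fun c _ => Finset.prod_pos fun j _ => Finset.prod_pos fun b _ =>
        causeFactor_pos c b.val ((h b.val b.2).2 c j)
end
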